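/- Let G be a group and let X and Y be cocompact G-trees with the same elliptic subgroups. If X is strongly slide-free and Y is reduced, then there is a unique isomorphism of G-trees X → Y. -/

import Mathlib

universe u

/-- A `G`-tree: a simplicial tree together with an action of `G` by graph
automorphisms without inversions. -/
structure GTree (G : Type u) [Group G] : Type (u + 1) where
  V : Type u
  graph : SimpleGraph V
  isTree : graph.IsTree
  smul : G → V → V
  smul_one : ∀ x, smul 1 x = x
  smul_mul : ∀ γ δ x, smul (γ * δ) x = smul γ (smul δ x)
  smul_adj : ∀ (γ : G) ⦃x y : V⦄, graph.Adj x y → graph.Adj (smul γ x) (smul γ y)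
  no_inversions : ∀ (γ : G) (x y : V), graph.Adj x y → ¬(smul γ x = y ∧ smul γ y = x)

namespace GTree

variable {G : Type u} [Group G]

/-- Oriented edges of a `G`-tree. -/
def Edge (X : GTree G) : Type u := { p : X.V × X.V // X.graph.Adj p.1 p.2 }

/-- Initial vertex `∂₀ e` of an oriented edge. -/
def d0 {X : GTree G} (e : X.Edge) : X.V := e.1.1

/-- Terminal vertex `∂₁ e` of an oriented edge. -/
def d1 {X : GTree G} (e : X.Edge) : X.V := e.1.2

/-- The underlying geometric (unoriented) edge. -/
def esym {X : GTree G} (e : X.Edge) : Sym2 X.V := s(e.1.1, e.1.2)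

/-- Action of `G` on oriented edges. -/
def edgeSmul {X : GTree G} (γ : G) (e : X.Edge) : X.Edge :=
  ⟨(X.smul γ e.1.1, X.smul γ e.1.2), X.smul_adj γ e.2⟩

/-- Vertex stabilizer `G_x`. -/
def stab (X : GTree G) (x : X.V) : Subgroup G where
  carrier := { γ | X.smul γ x = x }
  one_mem' := X.smul_one x
  mul_mem' := by
    intro a b ha hb
    simp only [Set.mem_setOf_eq] at *
    rw [X.smul_mul, hb, ha]
  inv_mem' := by
    intro a ha
    simp only [Set.mem_setOf_eq] at *
    conv_lhs => rw [← ha]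
    rw [← X.smul_mul, inv_mul_cancel, X.smul_one]

/-- Edge stabilizer `G_e`: the elements fixing both endpoints (since the action
is without inversions, these are exactly the elements fixing the edge). -/
def edgeStab (X : GTree G) (e : X.Edge) : Subgroup G :=
  X.stab (d0 e) ⊓ X.stab (d1 e)

/-- An element of `G` is elliptic if it fixes a vertex. -/
def Elliptic (X : GTree G) (γ : G) : Prop := ∃ x, X.smul γ x = x

/-- A subgroup of `G` is elliptic if it fixes a vertex. -/
def FixesVertex (X : GTree G) (H : Subgroup G) : Prop := ∃ x, ∀ γ ∈ H, X.smul γ x = x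

/-- Two `G`-trees have the same elliptic subgroups. -/
def SameEllipticSubgroups (X Y : GTree G) : Prop :=
  ∀ H : Subgroup G, X.FixesVertex H ↔ Y.FixesVertex H

/-- The length function `ℓ_X(γ)`: the minimal vertex displacement. -/
noncomputable def transLen (X : GTree G) (γ : G) : ℕ :=
  sInf (Set.range fun x => X.graph.dist x (X.smul γ x))

/-- Cocompact: the quotient graph `G\X` is finite, i.e. there are finitely
many orbits of vertices and of edges. -/
def Cocompact (X : GTree G) : Prop :=
  Finite (Quot fun x y : X.V => ∃ γ, X.smul γ x = y) ∧
    Finite (Quot fun e f : X.Edge => ∃ γ, edgeSmul γ e = f)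

/-- Reduced: whenever `G_e = G_{∂₀ e}`, the endpoints of `e` are in the same
`G`-orbit. -/
def Reduced (X : GTree G) : Prop :=
  ∀ e : X.Edge, X.edgeStab e = X.stab (d0 e) → ∃ γ, X.smul γ (d0 e) = d1 e

/-- A nonempty `G`-invariant subtree (a nonempty invariant set of vertices that
is connected in the induced graph). -/
def IsInvariantSubtree (X : GTree G) (S : Set X.V) : Prop :=
  S.Nonempty ∧ (∀ γ, ∀ x ∈ S, X.smul γ x ∈ S) ∧
    ∀ x ∈ S, ∀ y ∈ S, ∃ p : X.graph.Walk x y, ∀ v ∈ p.support, v ∈ S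

/-- Minimal: there is no proper nonempty invariant subtree. -/
def Minimal (X : GTree G) : Prop :=
  ∀ S : Set X.V, X.IsInvariantSubtree S → S = Set.univ

/-- Strongly slide-free: minimal, and for all edges `e`, `f` with
`∂₀ e = ∂₀ f`, the inclusion `G_e ⊆ G_f` implies `f ∈ G e`. -/
def StronglySlideFree (X : GTree G) : Prop :=
  X.Minimal ∧ ∀ e f : X.Edge, d0 e = d0 f → X.edgeStab e ≤ X.edgeStab f →
    ∃ γ, edgeSmul γ e = f

/-- Proper: `G_e ⊊ G_{∂₀ e}` for every edge `e`. -/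
def Proper (X : GTree G) : Prop := ∀ e : X.Edge, X.edgeStab e < X.stab (d0 e)

/-- Locally finite: every vertex has finite valence. -/
def LocallyFinite (X : GTree G) : Prop := ∀ x : X.V, (X.graph.neighborSet x).Finite

/-- `φ` is an isomorphism of `G`-trees: an equivariant graph isomorphism. -/
def IsGIso (X Y : GTree G) (φ : X.V → Y.V) : Prop :=
  Function.Bijective φ ∧ (∀ x y, X.graph.Adj x y ↔ Y.graph.Adj (φ x) (φ y)) ∧
    ∀ γ x, φ (X.smul γ x) = Y.smul γ (φ x)

/-- `φ : X → Y` is the collapse move performed at (the orbit of) the edge `e`: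
`G_e = G_{∂₀ e}`, the endpoints of `e` lie in different `G`-orbits, and `Y` is
the equivariant quotient of `X` identifying `∂₀(γ e)` with `∂₁(γ e)` for all
`γ ∈ G`. -/
def IsCollapse (X Y : GTree G) (φ : X.V → Y.V) (e : X.Edge) : Prop :=
  X.edgeStab e = X.stab (d0 e) ∧
  (∀ γ : G, X.smul γ (d0 e) ≠ d1 e) ∧
  Function.Surjective φ ∧
  (∀ γ x, φ (X.smul γ x) = Y.smul γ (φ x)) ∧
  (∀ u v : X.V, φ u = φ v ↔
    Relation.EqvGen (fun a b => ∃ γ : G, a = X.smul γ (d0 e) ∧ b = X.smul γ (d1 e)) u v) ∧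
  (∀ a b : Y.V, a ≠ b → (Y.graph.Adj a b ↔ ∃ u v, X.graph.Adj u v ∧ φ u = a ∧ φ v = b))

/-- `Y` is obtained from `X` by a collapse move. -/
def Collapse (X Y : GTree G) : Prop := ∃ (φ : X.V → Y.V) (e : X.Edge), IsCollapse X Y φ e

/-- Elementary deformation: a finite composition of collapse moves and their
inverses (expansion moves). -/
def ElemDeformation : GTree G → GTree G → Prop := Relation.EqvGen Collapse

end GTree

namespace SimpleGraph

variable {V : Type*} {T : SimpleGraph V}

/-- `m` lies on every walk from `p` to `r`; in a tree, this means that `m` lies on the geodesic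
from `p` to `r`. -/
def Between (T : SimpleGraph V) (p m r : V) : Prop := ∀ w : T.Walk p r, m ∈ w.support

namespace Between

variable {p q m n r : V}

theorem left (p r : V) : T.Between p p r := fun w => w.start_mem_support

theorem right (p r : V) : T.Between p r r := fun w => w.end_mem_support

theorem symm (h : T.Between p m r) : T.Between r m p := fun w => by
  simpa using h w.reverse

theorem eq_of_self (h : T.Between p m p) : m = p := by
  simpa using h Walk.nil

theorem or_of_between (h : T.Between p m r) (q : V) : T.Between p m q ∨ T.Between q m r := by
  by_contra! hc
  simp only [Between, not_forall] at hc
  obtain ⟨⟨w₁, h₁⟩, w₂, h₂⟩ := hc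
  have := h (w₁.append w₂)
  rw [Walk.mem_support_append_iff] at this
  tauto

theorem trans (h : T.Between p m r) (h' : T.Between p n m) : T.Between p n r := fun w => by
  classical
  exact w.support_takeUntil_subset_support (h w) (h' (w.takeUntil m (h w)))

theorem map {W : Type*} {S : SimpleGraph W} (f : T ≃g S) (h : T.Between p m r) :
    S.Between (f p) (f m) (f r) := fun w => by
  have := h ((w.map f.symm.toHom).copy (f.symm_apply_apply p) (f.symm_apply_apply r))
  simp only [Walk.support_copy, Walk.support_map, List.mem_map] at this
  obtain ⟨a, ha, hm⟩ := this
  have : a = f m := by rw [← hm]; exact (f.apply_symm_apply a).symm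
  exact this ▸ ha

end Between

namespace IsTree

variable {p q m n r u v : V}

theorem between_of_isPath (hT : T.IsTree) {w : T.Walk p r} (hw : w.IsPath) (hm : m ∈ w.support) :
    T.Between p m r := fun w' => by
  classical
  have := (hT.existsUnique_path p r).unique hw w'.bypass_isPath
  exact w'.support_bypass_subset_support (this ▸ hm)

theorem between_antisymm (hT : T.IsTree) (h : T.Between p m r) (h' : T.Between m p r) : m = p := by
  classical
  obtain ⟨w, hw, -⟩ := hT.existsUnique_path p r
  by_contra hne
  have hm := h w
  rw [← w.take_spec hm] at hw
  exact hw.ne_of_mem_support_of_append (Ne.symm hne) (Walk.start_mem_support _) (h' _) rfl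

theorem length_eq_dist_of_isPath (hT : T.IsTree) {w : T.Walk p r} (hw : w.IsPath) :
    w.length = T.dist p r := by
  obtain ⟨w', hw', h⟩ := hT.connected.exists_path_of_dist p r
  rw [(hT.existsUnique_path p r).unique hw hw', h]

theorem eq_of_between_of_dist_eq (hT : T.IsTree) (hm : T.Between p m r) (hn : T.Between p n r)
    (h : T.dist p m = T.dist p n) : m = n := by
  classical
  obtain ⟨w, hw, -⟩ := hT.existsUnique_path p r
  have key : ∀ x, T.Between p x r → w.getVert (T.dist p x) = x := fun x hx => by
    rw [← hT.length_eq_dist_of_isPath (hw.takeUntil (hx w))]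
    exact w.getVert_length_takeUntil (hx w)
  rw [← key m hm, ← key n hn, h]

theorem exists_adj_between (hT : T.IsTree) (h : p ≠ r) : ∃ q, T.Adj p q ∧ T.Between p q r := by
  obtain ⟨w, hw, -⟩ := hT.existsUnique_path p r
  cases w with
  | nil => exact absurd rfl h
  | cons h' w' => exact ⟨_, h', hT.between_of_isPath hw (by simp)⟩

theorem between_or_between_of_adj (hT : T.IsTree) (z : V) (h : T.Adj u v) :
    T.Between z u v ∨ T.Between z v u := by
  obtain ⟨w, hw, -⟩ := hT.existsUnique_path z u
  by_cases hv : v ∈ w.support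
  · exact .inr (hT.between_of_isPath hw hv)
  · exact .inl (hT.between_of_isPath (hw.concat hv h) (by simp))

theorem exists_ne_adj_adj_of_between (hT : T.IsTree) (h : T.Between p m r) (hp : m ≠ p)
    (hr : m ≠ r) : ∃ u v, u ≠ v ∧ T.Adj m u ∧ T.Adj m v := by
  obtain ⟨u, hu, hup⟩ := hT.exists_adj_between hp
  obtain ⟨v, hv, hvr⟩ := hT.exists_adj_between hr
  refine ⟨u, v, ?_, hu, hv⟩
  rintro rfl
  rcases h.or_of_between u with h | h
  · exact hu.ne (hT.between_antisymm h.symm hup)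
  · exact hu.ne (hT.between_antisymm h hvr)

theorem not_adj_of_adj_of_adj (hT : T.IsTree) (h₁ : T.Adj p q) (h₂ : T.Adj q r) :
    ¬ T.Adj p r := fun h => by
  have h3 := hT.dist_ne_of_adj p h₂
  rw [dist_eq_one_iff_adj.2 h₁, dist_eq_one_iff_adj.2 h] at h3
  exact h3 rfl

theorem between_of_forall_dist_le (hT : T.IsTree) {P : T.Walk p r} (hP : P.IsPath)
    (hm : m ∈ P.support) (hmin : ∀ x ∈ P.support, T.dist q m ≤ T.dist q x) :
    T.Between q m r := by
  classical
  obtain ⟨Q, hQ, -⟩ := hT.existsUnique_path q m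
  have hD := hP.dropUntil hm
  have hpath : (Q.append (P.dropUntil m hm)).IsPath := by
    rw [Walk.isPath_def, Walk.support_append, List.nodup_append]
    refine ⟨hQ.support_nodup, hD.support_nodup.tail, ?_⟩
    rintro x hxQ _ hxD rfl
    have hxP := P.support_dropUntil_subset_support hm (List.mem_of_mem_tail hxD)
    by_cases hxm : x = m
    · subst hxm
      have := hD.support_nodup
      rw [← Walk.cons_tail_support] at this
      exact (List.nodup_cons.1 this).1 hxD
    · have h₁ := hmin x hxP
      have h₂ := Walk.length_takeUntil_lt_length hxQ hxm
      rw [hT.length_eq_dist_of_isPath hQ, hT.length_eq_dist_of_isPath (hQ.takeUntil hxQ)] at h₂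
      omega
  exact hT.between_of_isPath hpath (by simp)

theorem exists_between_between_between (hT : T.IsTree) (p q r : V) :
    ∃ m, T.Between p m q ∧ T.Between q m r ∧ T.Between p m r := by
  obtain ⟨P, hP, -⟩ := hT.existsUnique_path p r
  have hne : {x | x ∈ P.support}.Nonempty := ⟨p, P.start_mem_support⟩
  obtain ⟨m, hm, hmin⟩ : ∃ m ∈ P.support, ∀ x ∈ P.support, T.dist q m ≤ T.dist q x :=
    ⟨_, Function.argminOn_mem (T.dist q) _ hne, fun x hx => Function.argminOn_le (T.dist q) _ hx⟩
  exact ⟨m, (hT.between_of_forall_dist_le hP.reverse (by simpa using hm) (by simpa using hmin)).symm,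
    hT.between_of_forall_dist_le hP hm hmin, hT.between_of_isPath hP hm⟩

theorem exists_isPath_notMem_support_of_adj (hT : T.IsTree) {b b' : V} (z : V)
    (hb : T.Adj b' b) : ∃ (v v' : V) (_ : T.Adj v' v) (w : T.Walk z v'),
      s(v, v') = s(b, b') ∧ w.IsPath ∧ v ∉ w.support := by
  classical
  obtain ⟨w, hw, -⟩ := hT.existsUnique_path z b'
  by_cases hbw : b ∈ w.support
  · exact ⟨b', b, hb.symm, w.takeUntil b hbw, Sym2.eq_swap, hw.takeUntil hbw,
      Walk.endpoint_notMem_support_takeUntil hw hbw hb.ne⟩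
  · exact ⟨b, b', hb, w, rfl, hw, hbw⟩

/-- A path leaving an edge and arriving at a disjoint edge extends to a path that contains
both edges. -/
theorem exists_isPath_of_adj_of_adj (hT : T.IsTree) {a a' b b' : V} (ha : T.Adj a a')
    (hb : T.Adj b' b) (hab : a ≠ b) (hab' : a ≠ b') (ha'b : a' ≠ b) (ha'b' : a' ≠ b') :
    ∃ (u u' v v' : V) (hu : T.Adj u u') (hv : T.Adj v' v) (w : T.Walk u' v'),
      s(u, u') = s(a, a') ∧ s(v, v') = s(b, b') ∧ (Walk.cons hu (w.concat hv)).IsPath ∧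
        w.length ≠ 0 := by
  classical
  obtain ⟨u, u', hu, w, hua, hw, huw⟩ := hT.exists_isPath_notMem_support_of_adj b' ha.symm
  have hrev : w.reverse.IsPath := hw.reverse
  have hurev : u ∉ w.reverse.support := by simpa using huw
  have hub : u ≠ b ∧ u' ≠ b ∧ u ≠ b' ∧ u' ≠ b' := by
    rcases Sym2.eq_iff.1 hua with ⟨rfl, rfl⟩ | ⟨rfl, rfl⟩ <;> simp [*]
  by_cases hbw : b ∈ w.reverse.support
  · refine ⟨u, u', b', b, hu.symm, hb.symm, w.reverse.takeUntil b hbw, hua, Sym2.eq_swap, ?_, ?_⟩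
    · refine Walk.IsPath.cons ((hrev.takeUntil hbw).concat
        (Walk.endpoint_notMem_support_takeUntil hrev hbw hb.ne) hb.symm) ?_
      have := fun h => hurev (w.reverse.support_takeUntil_subset_support hbw h)
      simpa [Walk.support_concat, hub] using this
    · exact fun h => hub.2.1 (Walk.eq_of_length_eq_zero h)
  · refine ⟨u, u', b, b', hu.symm, hb, w.reverse, hua, rfl, ?_, ?_⟩
    · exact Walk.IsPath.cons (hrev.concat hbw hb) (by simp [Walk.support_concat, huw, hub])
    · exact fun h => hub.2.2.2 (Walk.eq_of_length_eq_zero h)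

end IsTree

end SimpleGraph

namespace GTree

variable {G : Type u} [Group G] {X Y : GTree G}

theorem mem_stab {γ : G} {x : X.V} : γ ∈ X.stab x ↔ X.smul γ x = x := Iff.rfl

theorem smul_inv_smul (γ : G) (x : X.V) : X.smul γ (X.smul γ⁻¹ x) = x := by
  rw [← X.smul_mul, mul_inv_cancel, X.smul_one]

theorem inv_smul_smul (γ : G) (x : X.V) : X.smul γ⁻¹ (X.smul γ x) = x := by
  rw [← X.smul_mul, inv_mul_cancel, X.smul_one]

theorem smul_injective (X : GTree G) (γ : G) : Function.Injective (X.smul γ) :=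
  Function.LeftInverse.injective (inv_smul_smul γ)

theorem mem_stab_smul {γ g : G} {x : X.V} :
    γ ∈ X.stab (X.smul g x) ↔ g⁻¹ * γ * g ∈ X.stab x := by
  rw [mem_stab, mem_stab, X.smul_mul, X.smul_mul]
  refine ⟨fun h => by rw [h, inv_smul_smul], fun h => ?_⟩
  rw [← smul_inv_smul g (X.smul γ (X.smul g x)), h]

/-- The graph automorphism given by the action of a group element. -/
def smulIso (X : GTree G) (γ : G) : X.graph ≃g X.graph where
  toFun := X.smul γ
  invFun := X.smul γ⁻¹
  left_inv := inv_smul_smul γ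
  right_inv := smul_inv_smul γ
  map_rel_iff' {x y} := by
    refine ⟨fun h => ?_, fun h => X.smul_adj γ h⟩
    have := X.smul_adj γ⁻¹ h
    simpa only [Equiv.coe_fn_mk, inv_smul_smul] using this

theorem between_smul (γ : G) {p m r : X.V} (h : X.graph.Between p m r) :
    X.graph.Between (X.smul γ p) (X.smul γ m) (X.smul γ r) :=
  h.map (X.smulIso γ)

theorem dist_smul (γ : G) (p q : X.V) :
    X.graph.dist (X.smul γ p) (X.smul γ q) = X.graph.dist p q := by
  have key : ∀ (δ : G) (p q : X.V), X.graph.dist (X.smul δ p) (X.smul δ q) ≤ X.graph.dist p q := by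
    intro δ p q
    obtain ⟨w, hw⟩ := X.isTree.connected.exists_walk_length_eq_dist p q
    rw [← hw, ← w.length_map (X.smulIso δ).toHom]
    exact SimpleGraph.dist_le _
  refine le_antisymm (key γ p q) ?_
  simpa only [inv_smul_smul] using key γ⁻¹ (X.smul γ p) (X.smul γ q)

theorem smul_eq_of_between {γ : G} {p m r : X.V} (h : X.graph.Between p m r)
    (h' : X.graph.Between p (X.smul γ m) r) (hp : X.smul γ p = p) : X.smul γ m = m := by
  refine X.isTree.eq_of_between_of_dist_eq h' h ?_
  conv_lhs => rw [← hp]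
  exact dist_smul γ p m

theorem inf_stab_le_stab_of_between {p m r : X.V} (h : X.graph.Between p m r) :
    X.stab p ⊓ X.stab r ≤ X.stab m := fun γ hγ => by
  have hγp : X.smul γ p = p := hγ.1
  have hγr : X.smul γ r = r := hγ.2
  have h' := between_smul γ h
  rw [hγp, hγr] at h'
  exact smul_eq_of_between h h' hγp

namespace StronglySlideFree

theorem exists_smul_eq (hX : X.StronglySlideFree) {x u v : X.V} (hu : X.graph.Adj x u)
    (hv : X.graph.Adj x v) (h : X.stab x ⊓ X.stab u ≤ X.stab v) :
    ∃ γ ∈ X.stab x, X.smul γ u = v := by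
  obtain ⟨γ, hγ⟩ := hX.2 ⟨(x, u), hu⟩ ⟨(x, v), hv⟩ rfl (le_inf inf_le_left h)
  have := congrArg Subtype.val hγ
  exact ⟨γ, congrArg Prod.fst this, congrArg Prod.snd this⟩

theorem not_stab_le_of_adj (hX : X.StronglySlideFree) {x u : X.V} (hu : X.graph.Adj x u) :
    ¬ X.stab x ≤ X.stab u := by
  intro hle
  have huniq : ∀ v, X.graph.Adj x v → v = u := fun v hv => by
    obtain ⟨γ, hγ, rfl⟩ := hX.exists_smul_eq hv hu (inf_le_left.trans hle)
    have := hle (inv_mem hγ)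
    rw [mem_stab, inv_smul_smul] at this
    exact this
  have huniq' : ∀ g v, X.graph.Adj (X.smul g x) v → v = X.smul g u := fun g v hv => by
    have := X.smul_adj g⁻¹ hv
    rw [inv_smul_smul] at this
    rw [← huniq _ this, smul_inv_smul]
  have hS : X.IsInvariantSubtree {v | ∀ g, X.smul g x ≠ v} := by
    refine ⟨⟨u, fun g hg => ?_⟩, fun γ v hv g hg => ?_, fun p hp q hq => ?_⟩
    · have := huniq' g x (hg ▸ hu.symm)
      exact X.no_inversions g x u hu ⟨hg, this.symm⟩
    · refine hv (γ⁻¹ * g) ?_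
      rw [X.smul_mul, hg, inv_smul_smul]
    · obtain ⟨w, hw, -⟩ := X.isTree.existsUnique_path p q
      refine ⟨w, fun v hv g hg => ?_⟩
      subst hg
      obtain ⟨u₁, u₂, hne, h₁, h₂⟩ := X.isTree.exists_ne_adj_adj_of_between
        (X.isTree.between_of_isPath hw hv) (hp g) (hq g)
      exact hne ((huniq' g _ h₁).trans (huniq' g _ h₂).symm)
  have := hX.1 _ hS
  have hx : x ∈ {v | ∀ g, X.smul g x ≠ v} := this ▸ Set.mem_univ x
  exact hx 1 (X.smul_one x)

theorem eq_of_stab_le (hX : X.StronglySlideFree) {x y : X.V} (h : X.stab x ≤ X.stab y) :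
    x = y := by
  by_contra hne
  obtain ⟨u, hu, hb⟩ := X.isTree.exists_adj_between hne
  exact hX.not_stab_le_of_adj hu ((le_inf le_rfl h).trans (inf_stab_le_stab_of_between hb))

end StronglySlideFree

theorem Reduced.exists_smul_eq (hY : Y.Reduced) {y z : Y.V} (h : Y.graph.Adj y z)
    (hle : Y.stab y ≤ Y.stab z) : ∃ g, Y.smul g y = z :=
  hY ⟨(y, z), h⟩ (le_antisymm inf_le_left (le_inf le_rfl hle))

theorem stab_smul_eq_stab_smul {x : X.V} {y : Y.V} (h : Y.stab y = X.stab x) (g : G) :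
    Y.stab (Y.smul g y) = X.stab (X.smul g x) := by
  ext γ
  rw [mem_stab_smul, mem_stab_smul, h]

theorem eq_of_stab_eq_of_stab_le (hX : X.StronglySlideFree) (hY : Y.Reduced) {x : X.V}
    {y z : Y.V} (hy : Y.stab y = X.stab x) (hle : Y.stab y ≤ Y.stab z) : y = z := by
  by_contra hne
  obtain ⟨y', hadj, hb⟩ := Y.isTree.exists_adj_between hne
  have hle' : Y.stab y ≤ Y.stab y' := (le_inf le_rfl hle).trans (inf_stab_le_stab_of_between hb)
  obtain ⟨g, rfl⟩ := hY.exists_smul_eq hadj hle'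
  rw [stab_smul_eq_stab_smul hy, hy] at hle'
  have hg : g ∈ Y.stab y := hy ▸ (hX.eq_of_stab_le hle').symm
  exact hadj.ne hg.symm

theorem exists_stab_eq (hell : X.SameEllipticSubgroups Y) (hX : X.StronglySlideFree) (x : X.V) :
    ∃ y, Y.stab y = X.stab x := by
  obtain ⟨y, hy⟩ := (hell (X.stab x)).1 ⟨x, fun _ h => h⟩
  obtain ⟨z, hz⟩ := (hell (Y.stab y)).2 ⟨y, fun _ h => h⟩
  have hxy : X.stab x ≤ Y.stab y := hy
  have hyz : Y.stab y ≤ X.stab z := hz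
  obtain rfl := hX.eq_of_stab_le (hxy.trans hyz)
  exact ⟨y, le_antisymm hyz hxy⟩

/-- A group element preserving a family of pairwise intersecting edges fixes a vertex common to
all of them. -/
theorem exists_center_of_pairwise_meet (X : GTree G) {E : X.V → X.V → Prop}
    (hadj : ∀ p q, E p q → X.graph.Adj p q) (hsymm : ∀ p q, E p q → E q p)
    (hmeet : ∀ p q r s, E p q → E r s → p = r ∨ p = s ∨ q = r ∨ q = s)
    (hne : ∃ p q, E p q) :
    ∃ x, (∀ p q, E p q → p = x ∨ q = x) ∧
      ∀ g, (∀ p q, E p q → E (X.smul g p) (X.smul g q)) → X.smul g x = x := by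
  obtain ⟨x, u, hxu, hx⟩ : ∃ x u, E x u ∧ ∀ p q, E p q → p = x ∨ q = x := by
    obtain ⟨a, b, hab⟩ := hne
    by_cases ha : ∀ p q, E p q → p = a ∨ q = a
    · exact ⟨a, b, hab, ha⟩
    push Not at ha
    obtain ⟨c, d, hcd, hca, hda⟩ := ha
    obtain ⟨e, hbe, hea⟩ : ∃ e, E b e ∧ e ≠ a := by
      rcases hmeet a b c d hab hcd with h | h | rfl | rfl
      · exact absurd h.symm hca
      · exact absurd h.symm hda
      · exact ⟨d, hcd, hda⟩
      · exact ⟨c, hsymm _ _ hcd, hca⟩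
    refine ⟨b, a, hsymm _ _ hab, fun p q hpq => ?_⟩
    by_contra! hb
    have htri := X.isTree.not_adj_of_adj_of_adj (hadj _ _ hab) (hadj _ _ hbe)
    have h₁ := hadj _ _ hpq
    have h₂ := h₁.symm
    have h₃ := hmeet a b p q hab hpq
    have h₄ := hmeet b e p q hbe hpq
    grind
  refine ⟨x, hx, fun g hg => ?_⟩
  by_contra hgx
  have hgu : X.smul g u = x := (hx _ _ (hg _ _ hxu)).resolve_left hgx
  have hxg := hsymm _ _ (hg _ _ hxu)
  rw [hgu] at hxg
  have hggx := (hx _ _ (hg _ _ hxg)).resolve_left hgx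
  exact X.no_inversions g x u (hadj _ _ hxu) ⟨X.smul_injective g (hggx.trans hgu.symm), hgu⟩

theorem exists_between_of_adj_of_between (hY : Y.Reduced) {φ : X.V → Y.V}
    (hφ : ∀ g x, φ (X.smul g x) = Y.smul g (φ x)) {y z : Y.V} (hadj : Y.graph.Adj y z)
    (hz : ∃ a b, Y.graph.Between (φ a) z (φ b)) : ∃ a b, Y.graph.Between (φ a) y (φ b) := by
  obtain ⟨a, b, hab⟩ := hz
  by_contra! hy
  have hle : Y.stab y ≤ Y.stab z := fun γ hγ => by
    have hγy : Y.smul γ y = y := hγ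
    by_contra hne
    have hadj' := Y.smul_adj γ hadj
    rw [hγy] at hadj'
    have hb : Y.graph.Between z y (Y.smul γ z) := by
      refine Y.isTree.between_of_isPath (w := .cons hadj.symm (.cons hadj' .nil)) ?_ (by simp)
      have : z ≠ Y.smul γ z := fun h => hne h.symm
      simp [hadj.ne', hadj'.ne, this]
    have hab' := between_smul γ hab
    rw [← hφ, ← hφ] at hab'
    rcases hb.or_of_between (φ a) with h | h
    · exact hy _ _ (hab.trans h.symm)
    · rcases h.or_of_between (φ (X.smul γ a)) with h | h
      · exact hy _ _ h
      · exact hy _ _ (hab'.trans h)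
  obtain ⟨g, rfl⟩ := hY.exists_smul_eq hadj hle
  have := between_smul g⁻¹ hab
  rw [inv_smul_smul, ← hφ, ← hφ] at this
  exact hy _ _ this

theorem exists_between (hY : Y.Reduced) {φ : X.V → Y.V}
    (hφ : ∀ g x, φ (X.smul g x) = Y.smul g (φ x)) (y : Y.V) :
    ∃ a b, Y.graph.Between (φ a) y (φ b) := by
  obtain ⟨x⟩ := X.isTree.connected.nonempty
  have key : ∀ (y z : Y.V) (_ : Y.graph.Walk y z), (∃ a b, Y.graph.Between (φ a) z (φ b)) →
      ∃ a b, Y.graph.Between (φ a) y (φ b) := by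
    intro y z w hz
    induction w with
    | nil => exact hz
    | cons h _ ih => exact exists_between_of_adj_of_between hY hφ h (ih hz)
  exact key y (φ x) (Y.isTree.connected y (φ x)).some ⟨x, x, .left _ _⟩

/-- If `φ` maps the ends of a walk to `y` and `z`, then each point between `y` and `z` lies between
the images of two consecutive vertices of the walk. -/
theorem exists_append_cons_of_between (φ : X.V → Y.V) {u v : X.V} (w : X.graph.Walk u v) {m : Y.V}
    (hm : Y.graph.Between (φ u) m (φ v)) (hw : w.length ≠ 0) :
    ∃ (p q : X.V) (w₁ : X.graph.Walk u p) (h : X.graph.Adj p q) (w₂ : X.graph.Walk q v),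
      w = w₁.append (.cons h w₂) ∧ Y.graph.Between (φ p) m (φ q) := by
  induction w with
  | nil => simp at hw
  | @cons u u' v h w ih =>
    rcases hm.or_of_between (φ u') with hm' | hm'
    · exact ⟨u, u', .nil, h, w, rfl, hm'⟩
    by_cases hw' : w.length = 0
    · obtain rfl := SimpleGraph.Walk.eq_of_length_eq_zero hw'
      exact ⟨u, u', .nil, h, w, rfl, hm⟩
    · obtain ⟨p, q, w₁, h', w₂, rfl, hb⟩ := ih hm' hw'
      exact ⟨p, q, .cons h w₁, h', w₂, rfl, hb⟩

/-- An equivariant map between the vertex sets of two trees that preserves stabilizers. -/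
structure StabPreserving (X Y : GTree G) (φ : X.V → Y.V) : Prop where
  map_smul : ∀ g x, φ (X.smul g x) = Y.smul g (φ x)
  stab_eq : ∀ x, Y.stab (φ x) = X.stab x

theorem exists_stabPreserving (hell : X.SameEllipticSubgroups Y) (hX : X.StronglySlideFree)
    (hY : Y.Reduced) : ∃ φ : X.V → Y.V, StabPreserving X Y φ := by
  choose φ hφ using exists_stab_eq hell hX
  refine ⟨φ, fun g x => eq_of_stab_eq_of_stab_le hX hY (hφ _) ?_, hφ⟩
  rw [stab_smul_eq_stab_smul (hφ x), hφ]

theorem IsGIso.stabPreserving {φ : X.V → Y.V} (h : IsGIso X Y φ) : StabPreserving X Y φ := by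
  refine ⟨h.2.2, fun x => ?_⟩
  ext γ
  rw [mem_stab, mem_stab, ← h.2.2, h.1.1.eq_iff]

namespace StabPreserving

variable {φ ψ : X.V → Y.V}

theorem eq (hφ : StabPreserving X Y φ) (hψ : StabPreserving X Y ψ) (hX : X.StronglySlideFree)
    (hY : Y.Reduced) : φ = ψ := by
  ext x
  exact eq_of_stab_eq_of_stab_le hX hY (hφ.stab_eq x) (by rw [hφ.stab_eq, hψ.stab_eq])

theorem injective (hφ : StabPreserving X Y φ) (hX : X.StronglySlideFree) :
    Function.Injective φ := fun x y h =>
  hX.eq_of_stab_le (by rw [← hφ.stab_eq, ← hφ.stab_eq, h])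

theorem smul_map_eq (hφ : StabPreserving X Y φ) {γ : G} {x : X.V} (h : γ ∈ X.stab x) :
    Y.smul γ (φ x) = φ x := by
  rw [← hφ.stab_eq] at h
  exact h

theorem not_between_of_stab_le (hφ : StabPreserving X Y φ) (hX : X.StronglySlideFree)
    {x u v z : X.V} {y : Y.V} (hu : X.graph.Adj x u) (hv : X.graph.Adj x v) (huv : u ≠ v)
    (hyu : Y.graph.Between (φ x) y (φ u)) (hyv : Y.graph.Between (φ x) y (φ v))
    (hyz : Y.stab y ≤ X.stab z) : ¬ X.graph.Between z u x := by
  intro hz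
  have hle : X.stab x ⊓ X.stab v ≤ X.stab u := fun γ hγ => by
    have hγy : γ ∈ Y.stab y := by
      apply inf_stab_le_stab_of_between hyv
      rwa [hφ.stab_eq, hφ.stab_eq]
    exact inf_stab_le_stab_of_between hz ⟨hyz hγy, hγ.1⟩
  obtain ⟨γ, hγ, hγv⟩ := hX.exists_smul_eq hv hu hle
  have hb := between_smul γ hyv
  rw [hφ.smul_map_eq hγ, ← hφ.map_smul, hγv] at hb
  have hγy : γ ∈ Y.stab y := smul_eq_of_between hyu hb (hφ.smul_map_eq hγ)
  have hγu : X.smul γ u = u := inf_stab_le_stab_of_between hz ⟨hyz hγy, hγ⟩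
  exact huv (X.smul_injective γ (hγu.trans hγv.symm))

theorem not_between_of_isPath (hφ : StabPreserving X Y φ) (hell : X.SameEllipticSubgroups Y)
    (hX : X.StronglySlideFree) {a a' b b' : X.V} (ha : X.graph.Adj a a') (hb : X.graph.Adj b' b)
    (w : X.graph.Walk a' b') (hw : w.length ≠ 0)
    (hpath : (SimpleGraph.Walk.cons ha (w.concat hb)).IsPath) {y : Y.V}
    (hya : Y.graph.Between (φ a) y (φ a')) : ¬ Y.graph.Between (φ b) y (φ b') := by
  induction hn : w.length using Nat.strong_induction_on generalizing a a' b b' y with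
  | _ n ih =>
  intro hyb
  have hab' : b' ≠ a := by
    rintro rfl
    exact ((SimpleGraph.Walk.cons_isPath_iff _ _).1 hpath).2
      (by simp [SimpleGraph.Walk.support_concat])
  have ha'b : a' ≠ b := by
    rintro rfl
    exact ((SimpleGraph.Walk.concat_isPath_iff hb).1 hpath.of_cons).2 w.start_mem_support
  obtain ⟨m, hma, hmb, hmab⟩ := Y.isTree.exists_between_between_between (φ a') y (φ b')
  replace hma := hya.symm.trans hma
  replace hmb := hyb.symm.trans hmb.symm
  obtain ⟨p, q, w₁, h, w₂, rfl, hm⟩ := exists_append_cons_of_between φ w hmab hw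
  have hlen : w₁.length + (w₂.length + 1) = n := by simpa using hn
  by_cases h₁ : w₁.length = 0
  · by_cases h₂ : w₂.length = 0
    · obtain rfl := SimpleGraph.Walk.eq_of_length_eq_zero h₁
      obtain rfl := SimpleGraph.Walk.eq_of_length_eq_zero h₂
      obtain ⟨z, hz⟩ := (hell (Y.stab m)).2 ⟨m, fun _ h => h⟩
      rcases X.isTree.between_or_between_of_adj z h with hzb | hzb
      · exact hφ.not_between_of_stab_le hX h.symm hb ha'b hm.symm hmb hz hzb
      · exact hφ.not_between_of_stab_le hX h ha.symm hab' hm hma hz hzb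
    · refine ih w₂.length (by lia) h hb w₂ h₂ ?_ hm rfl hmb.symm
      apply SimpleGraph.Walk.IsPath.of_append_right (p := SimpleGraph.Walk.cons ha w₁)
      simpa [SimpleGraph.Walk.concat_eq_append, ← SimpleGraph.Walk.append_assoc] using hpath
  · refine ih w₁.length (by lia) ha h w₁ h₁ ?_ hma.symm rfl hm.symm
    apply SimpleGraph.Walk.IsPath.of_append_left (q := w₂.concat hb)
    simpa [SimpleGraph.Walk.concat_eq_append, ← SimpleGraph.Walk.append_assoc] using hpath

theorem eq_or_eq_of_between (hφ : StabPreserving X Y φ) (hell : X.SameEllipticSubgroups Y)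
    (hX : X.StronglySlideFree) {a a' b b' : X.V} (ha : X.graph.Adj a a') (hb : X.graph.Adj b b')
    {y : Y.V} (hya : Y.graph.Between (φ a) y (φ a')) (hyb : Y.graph.Between (φ b) y (φ b')) :
    a = b ∨ a = b' ∨ a' = b ∨ a' = b' := by
  by_contra! hne
  obtain ⟨u, u', v, v', hu, hv, w, huu', hvv', hpath, hw⟩ :=
    X.isTree.exists_isPath_of_adj_of_adj ha hb.symm hne.1 hne.2.1 hne.2.2.1 hne.2.2.2
  refine hφ.not_between_of_isPath hell hX hu hv w hw hpath (y := y) ?_ ?_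
  · rcases Sym2.eq_iff.1 huu' with ⟨rfl, rfl⟩ | ⟨rfl, rfl⟩
    exacts [hya, hya.symm]
  · rcases Sym2.eq_iff.1 hvv' with ⟨rfl, rfl⟩ | ⟨rfl, rfl⟩
    exacts [hyb, hyb.symm]

theorem mem_range_of_between (hφ : StabPreserving X Y φ) (hell : X.SameEllipticSubgroups Y)
    (hX : X.StronglySlideFree) (hY : Y.Reduced) {a b : X.V} {y : Y.V} (hab : X.graph.Adj a b)
    (hy : Y.graph.Between (φ a) y (φ b)) : y ∈ Set.range φ := by
  obtain ⟨x, hx, hfix⟩ := X.exists_center_of_pairwise_meet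
    (E := fun p q => X.graph.Adj p q ∧ Y.graph.Between (φ p) y (φ q)) (fun p q h => h.1)
    (fun p q h => ⟨h.1.symm, h.2.symm⟩)
    (fun p q r s h h' => hφ.eq_or_eq_of_between hell hX h.1 h'.1 h.2 h'.2) ⟨a, b, hab, hy⟩
  refine ⟨x, ?_⟩
  by_contra hne
  obtain ⟨y', hadj, hy'⟩ := Y.isTree.exists_adj_between (Ne.symm hne)
  have hle : Y.stab y ≤ Y.stab (φ x) := fun γ hγ => by
    rw [hφ.stab_eq]
    refine hfix γ fun p q h => ⟨X.smul_adj γ h.1, ?_⟩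
    have := between_smul γ h.2
    rwa [mem_stab.1 hγ, ← hφ.map_smul, ← hφ.map_smul] at this
  obtain ⟨g, rfl⟩ := hY.exists_smul_eq hadj
    ((le_inf le_rfl hle).trans (inf_stab_le_stab_of_between hy'))
  have hg : g⁻¹ ∈ X.stab x := by
    refine hfix g⁻¹ fun p q h => ⟨X.smul_adj _ h.1, ?_⟩
    have hb : Y.graph.Between (φ p) (Y.smul g y) (φ q) := by
      rcases hx p q h with rfl | rfl
      · exact h.2.trans hy'.symm
      · exact (h.2.symm.trans hy'.symm).symm
    have := between_smul g⁻¹ hb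
    rwa [inv_smul_smul, ← hφ.map_smul, ← hφ.map_smul] at this
  have hg' := hφ.smul_map_eq (inv_inv g ▸ inv_mem hg)
  exact hadj.ne (smul_eq_of_between (.right _ _) hy'.symm hg').symm

theorem surjective (hφ : StabPreserving X Y φ) (hell : X.SameEllipticSubgroups Y)
    (hX : X.StronglySlideFree) (hY : Y.Reduced) : Function.Surjective φ := fun y => by
  obtain ⟨a, b, hab⟩ := exists_between hY hφ.map_smul y
  by_cases hne : a = b
  · subst hne
    exact ⟨a, hab.eq_of_self.symm⟩
  obtain ⟨w⟩ := X.isTree.connected a b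
  obtain ⟨p, q, -, h, -, -, hb⟩ := exists_append_cons_of_between φ w hab
    fun h => hne (SimpleGraph.Walk.eq_of_length_eq_zero h)
  exact hφ.mem_range_of_between hell hX hY h hb

theorem adj_of_adj (hφ : StabPreserving X Y φ) (hell : X.SameEllipticSubgroups Y)
    (hX : X.StronglySlideFree) (hY : Y.Reduced) {a b : X.V} (hab : X.graph.Adj a b) :
    Y.graph.Adj (φ a) (φ b) := by
  obtain ⟨y, hadj, hb⟩ := Y.isTree.exists_adj_between ((hφ.injective hX).ne hab.ne)
  obtain ⟨x, rfl⟩ := hφ.surjective hell hX hY y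
  by_cases hxb : x = b
  · rwa [hxb] at hadj
  have hxa : x ≠ a := fun h => hadj.ne (congrArg φ h.symm)
  obtain ⟨u, hu, -⟩ := X.isTree.exists_adj_between hxa
  obtain ⟨γ, hγ, hγu⟩ := SetLike.not_le_iff_exists.1 (hX.not_stab_le_of_adj hu)
  have hu' := X.smul_adj γ hu
  rw [mem_stab.1 hγ] at hu'
  have hγu' : X.smul γ u ≠ u := hγu
  have h₁ := hφ.eq_or_eq_of_between hell hX hu hab (.left _ _) hb
  have h₂ := hφ.eq_or_eq_of_between hell hX hu' hab (.left _ _) hb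
  have htri := X.isTree.not_adj_of_adj_of_adj hu.symm hu'
  have hab' := hab.symm
  grind

theorem isGIso (hφ : StabPreserving X Y φ) (hell : X.SameEllipticSubgroups Y)
    (hX : X.StronglySlideFree) (hY : Y.Reduced) : IsGIso X Y φ := by
  refine ⟨⟨hφ.injective hX, hφ.surjective hell hX hY⟩,
    fun a b => ⟨hφ.adj_of_adj hell hX hY, fun h => ?_⟩, hφ.map_smul⟩
  obtain ⟨w, hw, -⟩ := X.isTree.existsUnique_path a b
  let f : X.graph →g Y.graph := ⟨φ, hφ.adj_of_adj hell hX hY⟩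
  have hlen := Y.isTree.length_eq_dist_of_isPath
    (SimpleGraph.Walk.IsPath.map (f := f) (hφ.injective hX) hw)
  rw [SimpleGraph.Walk.length_map] at hlen
  exact SimpleGraph.Walk.adj_of_length_eq_one (hlen.trans (SimpleGraph.dist_eq_one_iff_adj.2 h))

end StabPreserving

end GTree

open GTree in
/-- Corollary C / Theorem 6.1: let `X` and `Y` be cocompact `G`-trees with the
same elliptic subgroups.  If `X` is strongly slide-free and `Y` is reduced,
then there is a unique isomorphism of `G`-trees `X → Y`. -/
theorem unique_iso_of_sameEllipticSubgroups {G : Type u} [Group G] (X Y : GTree G)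
    (hXc : X.Cocompact) (hYc : Y.Cocompact)
    (hell : X.SameEllipticSubgroups Y)
    (hssf : X.StronglySlideFree) (hred : Y.Reduced) :
    ∃! φ : X.V → Y.V, IsGIso X Y φ := by
  obtain ⟨φ, hφ⟩ := exists_stabPreserving hell hssf hred
  exact ⟨φ, hφ.isGIso hell hssf hred, fun ψ hψ => hψ.stabPreserving.eq hφ hssf hred⟩
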